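/- Let W be the kernel classifier over ℝ^d × {±1} constructed from kernel function K: [0,∞) → [0,∞) and bandwidths (h_n). Suppose: (1) K is decreasing and ∫_{ℝ^d} K(‖x‖) dx < ∞; (2) lim_{n→∞} h_n = 0 and lim_{n→∞} n·h_n^d = ∞; (3) for every c > 1, lim_{x→∞} K(cx)/K(x) = 0; (4) for every x ≥ 0, lim_{n→∞} (n/log n)·K(x/h_n) = ∞. Then W is neighborhood consistent: for every data distribution D = (μ, η) with η continuous (and all robustness regions contained in a common compact set) and all 0 < ε, δ, κ < 1, there exists N such that for all n ≥ N, with probability at least 1 − δ over S ∼ D^n, A_{V^κ}(W_S, D) ≥ A(g, D) − ε. -/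

import Mathlib

open MeasureTheory Metric Set Filter Topology
open scoped ENNReal Classical

noncomputable section

/-- The real value of a `Bool` label: `true ↦ +1`, `false ↦ -1`. -/
def labelVal (b : Bool) : ℝ := if b then 1 else -1

abbrev Eucl (d : ℕ) : Type := EuclideanSpace ℝ (Fin d)

section BasicDefs

variable {E : Type*} [MeasurableSpace E]

/-- The joint distribution on instance-label pairs determined by the marginal `μ`
and the regression function `η` (label `+1` with probability `η x`). -/
def jointD (μ : Measure E) (η : E → ℝ) : Measure (E × Bool) :=
  μ.bind fun x =>
    ENNReal.ofReal (η x) • Measure.dirac (x, true) +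
      ENNReal.ofReal (1 - η x) • Measure.dirac (x, false)

/-- The distribution of an i.i.d. sample of size `n` from `D = (μ, η)`. -/
def sampleD (μ : Measure E) (η : E → ℝ) (n : ℕ) : Measure (Fin n → E × Bool) :=
  Measure.pi fun _ => jointD μ η

/-- The accuracy `A(f, D) = P_{(x,y) ∼ D}[f x = y]`. -/
def accuracy (μ : Measure E) (η : E → ℝ) (f : E → Bool) : ℝ :=
  (jointD μ η {p | f p.1 = p.2}).toReal

/-- The astuteness `A_U(f, D) = P_{(x,y) ∼ D}[f x' = y for all x' ∈ U x]`. -/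
def astuteness (μ : Measure E) (η : E → ℝ) (U : E → Set E) (f : E → Bool) : ℝ :=
  (jointD μ η {p | ∀ x' ∈ U p.1, f x' = p.2}).toReal

/-- The Bayes optimal classifier: `+1` iff `η x ≥ 1/2`. -/
def bayes (η : E → ℝ) : E → Bool := fun x => if (1/2 : ℝ) ≤ η x then true else false

end BasicDefs

section MetricDefs

variable {E : Type*} [MetricSpace E]

/-- The neighborhood preserving Bayes optimal classifier:
`+1` at `x` iff `ρ(x, μ⁺) ≤ ρ(x, μ⁻)`. -/
def gNeighbor (η : E → ℝ) : E → Bool := fun x =>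
  if infDist x {z | (1/2 : ℝ) < η z} ≤ infDist x {z | η z < (1/2 : ℝ)} then true else false

/-- The neighborhood preserving robustness region `V_x`. -/
def nbhdRegion (η : E → ℝ) (x : E) : Set E :=
  if (1/2 : ℝ) < η x then {x' | dist x x' < infDist x' {z | η z ≤ (1/2 : ℝ)}}
  else if η x < (1/2 : ℝ) then {x' | dist x x' < infDist x' {z | (1/2 : ℝ) ≤ η z}}
  else {x}

/-- The partial neighborhood preserving robustness region `V_x^κ`. -/
def nbhdRegionK (η : E → ℝ) (κ : ℝ) (x : E) : Set E :=
  if (1/2 : ℝ) < η x then {x' | dist x x' < κ * infDist x' {z | η z ≤ (1/2 : ℝ)}}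
  else if η x < (1/2 : ℝ) then {x' | dist x x' < κ * infDist x' {z | (1/2 : ℝ) ≤ η z}}
  else {x}

variable [MeasurableSpace E]

/-- The support of a measure: all points whose balls all have positive mass. -/
def msupport (μ : Measure E) : Set E := {x | ∀ r > 0, 0 < μ (Metric.ball x r)}

/-- `D⁺`: points of the support where `η > 1/2`. -/
def Dplus (μ : Measure E) (η : E → ℝ) : Set E := {x | x ∈ msupport μ ∧ (1/2 : ℝ) < η x}

/-- `D⁻`: points of the support where `η < 1/2`. -/
def Dminus (μ : Measure E) (η : E → ℝ) : Set E := {x | x ∈ msupport μ ∧ η x < (1/2 : ℝ)}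

/-- `D_{1/2}`: points of the support where `η = 1/2`. -/
def Dhalf (μ : Measure E) (η : E → ℝ) : Set E := {x | x ∈ msupport μ ∧ η x = (1/2 : ℝ)}

/-- The partial neighborhood preserving robustness region `V_x^κ`, support version. -/
def nbhdRegionKSupp (μ : Measure E) (η : E → ℝ) (κ : ℝ) (x : E) : Set E :=
  if x ∈ Dplus μ η then {x' | dist x x' < κ * infDist x' (Dminus μ η ∪ Dhalf μ η)}
  else if x ∈ Dminus μ η then {x' | dist x x' < κ * infDist x' (Dplus μ η ∪ Dhalf μ η)}
  else {x}

/-- The probability radius `r_p(x) = inf {r : μ(B(x,r)) ≥ p}`. -/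
def probRadius (μ : Measure E) (p : ℝ) (x : E) : ℝ :=
  sInf {r : ℝ | ENNReal.ofReal p ≤ μ (closedBall x r)}

/-- `r_p^ε(x) = sup {r : μ(B(x,r)) − μ(B(x,r_p(x))) ≤ ε}`. -/
def probRadiusEps (μ : Measure E) (p ε : ℝ) (x : E) : ℝ :=
  sSup {r : ℝ | (μ (closedBall x r)).toReal - (μ (closedBall x (probRadius μ p x))).toReal ≤ ε}

/-- `x` is `(p, Δ)`-covered: for all `x' ∈ U x` and all
`x'' ∈ B(x', r_p(x')) ∩ supp(μ)`, `η x'' > 1/2 + Δ`. -/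
def Covered (μ : Measure E) (η : E → ℝ) (U : E → Set E) (p Δ : ℝ) (x : E) : Prop :=
  ∀ x' ∈ U x, ∀ x'' ∈ closedBall x' (probRadius μ p x') ∩ msupport μ, 1/2 + Δ < η x''

end MetricDefs

/-- A weight function: for each sample of instances it produces nonnegative
weights summing to one, depending only on the instances. -/
structure WeightFn (E : Type*) where
  w : (n : ℕ) → (Fin n → E) → Fin n → E → ℝ
  nonneg : ∀ n xs i x, 0 ≤ w n xs i x
  le_one : ∀ n xs i x, w n xs i x ≤ 1
  sum_one : ∀ (n : ℕ) (xs : Fin n → E) (x : E), 0 < n → ∑ i, w n xs i x = 1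

/-- The classifier learned by a weight function from the sample `S`:
`+1` iff `∑ i, w_i(x) y_i > 0`. -/
def WeightFn.classify {E : Type*} (W : WeightFn E) {n : ℕ} (S : Fin n → E × Bool) : E → Bool :=
  fun x => if 0 < ∑ i, W.w n (fun j => (S j).1) i x * labelVal (S i).2 then true else false

/-- The splitting number of a family of weights on a fixed sample: the number of
distinct sets `{i : ρ(x, x_i) ≤ α, w_i(x) ≥ β}`. -/
def splitNumRaw {E : Type*} [MetricSpace E] {n : ℕ} (xs : Fin n → E) (w : Fin n → E → ℝ) : ℕ :=
  Set.ncard {T : Set (Fin n) | ∃ (x : E) (α β : ℝ), 0 ≤ α ∧ β ∈ Icc (0:ℝ) 1 ∧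
    T = {i | dist x (xs i) ≤ α ∧ β ≤ w i x}}

/-- The splitting number `T(W, S)` of a weight function. -/
def WeightFn.splitNum {E : Type*} [MetricSpace E] (W : WeightFn E) {n : ℕ}
    (xs : Fin n → E) : ℕ :=
  splitNumRaw xs (W.w n xs)

/-- Consistency with respect to accuracy: the accuracy of the learned classifier
converges in probability to the accuracy of the Bayes optimal classifier. -/
def ConsistentAcc {E : Type*} [MeasurableSpace E] (W : WeightFn E)
    (μ : Measure E) (η : E → ℝ) : Prop :=
  ∀ ε > (0:ℝ), ∀ δ > (0:ℝ), ∃ N : ℕ, ∀ n ≥ N,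
    ENNReal.ofReal (1 - δ) ≤
      sampleD μ η n {S | accuracy μ η (bayes η) - ε ≤ accuracy μ η (W.classify S)}

/-- Neighborhood consistency: for all `0 < ε, δ, κ < 1`, eventually with probability
at least `1 - δ` the astuteness w.r.t. `V^κ` is at least `A(g, D) - ε`. -/
def NbhdConsistent {E : Type*} [MetricSpace E] [MeasurableSpace E] (W : WeightFn E)
    (μ : Measure E) (η : E → ℝ) : Prop :=
  ∀ ε ∈ Ioo (0:ℝ) 1, ∀ δ ∈ Ioo (0:ℝ) 1, ∀ κ ∈ Ioo (0:ℝ) 1, ∃ N : ℕ, ∀ n ≥ N,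
    ENNReal.ofReal (1 - δ) ≤
      sampleD μ η n {S | accuracy μ η (bayes η) - ε ≤
        astuteness μ η (nbhdRegionK η κ) (W.classify S)}

/-- Condition 2 of the main theorem: vanishing expected supremal weight outside
the probability-radius balls. -/
def Cond2 {E : Type*} [MetricSpace E] [MeasurableSpace E] (W : WeightFn E)
    (μ : Measure E) (η : E → ℝ) : Prop :=
  ∀ p ∈ Ioo (0:ℝ) 1,
    Tendsto (fun n => ∫ S, (⨆ x : E, ∑ i, W.w n (fun j => (S j).1) i x *
      (if probRadius μ p x < dist x ((S i).1) then (1:ℝ) else 0)) ∂ sampleD μ η n)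
      atTop (nhds 0)

/-- Condition 3 of the main theorem: `E[t_n · sup_x max_i w_i(x)] → 0`. -/
def Cond3 {E : Type*} [MetricSpace E] [MeasurableSpace E] (W : WeightFn E)
    (μ : Measure E) (η : E → ℝ) (t : ℕ → ℕ) : Prop :=
  Tendsto (fun n => ∫ S, (t n : ℝ) *
    (⨆ x : E, ⨆ i, W.w n (fun j => (S j).1) i x) ∂ sampleD μ η n) atTop (nhds 0)

/-- Condition 4 of the main theorem: `E[log T(W,S) / t_n] → 0`. -/
def Cond4 {E : Type*} [MetricSpace E] [MeasurableSpace E] (W : WeightFn E)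
    (μ : Measure E) (η : E → ℝ) (t : ℕ → ℕ) : Prop :=
  Tendsto (fun n => ∫ S, Real.log (W.splitNum (fun j => (S j).1)) / (t n : ℝ)
    ∂ sampleD μ η n) atTop (nhds 0)

/-- `f` is a `k`-nearest neighbor classifier for the labelled sample `(xs, ys)`:
at every query point it takes a majority vote over some set of `k` nearest points. -/
def IsKNNClassifier {E : Type*} [MetricSpace E] {n : ℕ} (k : ℕ)
    (xs : Fin n → E) (ys : Fin n → Bool) (f : E → Bool) : Prop :=
  ∀ x : E, ∃ T : Finset (Fin n), T.card = min k n ∧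
    (∀ i ∈ T, ∀ j ∉ T, dist x (xs i) ≤ dist x (xs j)) ∧
    (f x = true ↔ 0 < ∑ i ∈ T, labelVal (ys i))

/-- `W` is the weight function of the `k_n`-nearest neighbor classifier. -/
def IsKNNWeightSeq {E : Type*} [MetricSpace E] (k : ℕ → ℕ) (W : WeightFn E) : Prop :=
  ∀ (n : ℕ) (xs : Fin n → E) (x : E), ∃ T : Finset (Fin n), T.card = min (k n) n ∧
    (∀ i ∈ T, ∀ j ∉ T, dist x (xs i) ≤ dist x (xs j)) ∧
    ∀ i, W.w n xs i x = if i ∈ T then ((min (k n) n : ℝ))⁻¹ else 0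

/-- `w` is the weight family of the `k`-nearest neighbor rule on the sample `xs`
with ties in distance broken by smaller value of `z`. -/
def IsKNNTieWeight {E : Type*} [MetricSpace E] {n : ℕ} (k : ℕ) (xs : Fin n → E)
    (z : Fin n → ℝ) (w : Fin n → E → ℝ) : Prop :=
  ∀ x : E, ∃ T : Finset (Fin n), T.card = min k n ∧
    (∀ i ∈ T, ∀ j ∉ T,
      dist x (xs i) < dist x (xs j) ∨ (dist x (xs i) = dist x (xs j) ∧ z i ≤ z j)) ∧
    ∀ i, w i x = if i ∈ T then ((min k n : ℝ))⁻¹ else 0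

/-- The kernel weights `w_i(x) = K(ρ(x,x_i)/h) / ∑_j K(ρ(x,x_j)/h)`. -/
def kernelW (K : ℝ → ℝ) (h : ℝ) {E : Type*} [MetricSpace E] {n : ℕ}
    (xs : Fin n → E) (i : Fin n) (x : E) : ℝ :=
  K (dist x (xs i) / h) / ∑ j, K (dist x (xs j) / h)

/-- The kernel classifier: `+1` iff `∑_i K(ρ(x,x_i)/h) y_i > 0`. -/
def kernelClassify (K : ℝ → ℝ) (h : ℝ) {E : Type*} [MetricSpace E] {n : ℕ}
    (S : Fin n → E × Bool) : E → Bool :=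
  fun x => if 0 < ∑ i, K (dist x ((S i).1) / h) * labelVal (S i).2 then true else false

end

section Combinatorics

/-- `T` is the set of indices of the points of `xs` inside some sphere that contains no point
of `xs`. -/
def BallCut {E : Type*} [MetricSpace E] {n : ℕ} (xs : Fin n → E) (T : Finset (Fin n)) : Prop :=
  ∃ (c : E) (t : ℝ), 0 < t ∧ (∀ i ∈ T, dist c (xs i) < t) ∧ ∀ i ∉ T, t < dist c (xs i)

lemma isOpen_ballCut {E : Type*} [MetricSpace E] {n : ℕ} (T : Finset (Fin n)) :
    IsOpen {xs : Fin n → E | BallCut xs T} := by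
  have : {xs : Fin n → E | BallCut xs T} =
      ⋃ (c : E) (t : ℝ) (_ : 0 < t), ((⋂ i ∈ T, {xs : Fin n → E | dist c (xs i) < t}) ∩
        ⋂ i ∈ Tᶜ, {xs : Fin n → E | t < dist c (xs i)}) := by
    ext xs
    simp only [BallCut, mem_ofPred_eq, mem_iUnion, mem_inter_iff, mem_iInter, Finset.mem_compl,
      exists_prop]
  rw [this]
  refine isOpen_iUnion fun c => isOpen_iUnion fun t => isOpen_iUnion fun _ => IsOpen.inter ?_ ?_
  · exact isOpen_biInter_finset fun i _ => isOpen_lt (by fun_prop) (by fun_prop)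
  · exact isOpen_biInter_finset fun i _ => isOpen_lt (by fun_prop) (by fun_prop)

lemma ballCut_closedBall {E : Type*} [MetricSpace E] {n : ℕ} (xs : Fin n → E) (c : E) {t : ℝ}
    (ht : 0 ≤ t) : BallCut xs (Finset.univ.filter fun i => dist c (xs i) ≤ t) := by
  have h1 : ∀ᶠ t' in 𝓝[>] t, ∀ i, t < dist c (xs i) → t' < dist c (xs i) := by
    rw [eventually_all]
    intro i
    by_cases hi : t < dist c (xs i)
    · filter_upwards [Ioo_mem_nhdsGT hi] with t' ht' _ using ht'.2
    · exact Eventually.of_forall fun _ h => absurd h hi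
  obtain ⟨t', h2, h3⟩ := (h1.and self_mem_nhdsWithin).exists
  refine ⟨c, t', ht.trans_lt h3, fun i hi => ?_, fun i hi => ?_⟩
  · simp only [Finset.mem_filter, Finset.mem_univ, true_and] at hi
    exact hi.trans_lt h3
  · simp only [Finset.mem_filter, Finset.mem_univ, true_and, not_le] at hi
    exact h2 i hi

lemma card_le_of_shatters_ballCut {d n : ℕ} (xs : Fin n → Eucl d) {A : Finset (Fin n)}
    (hA : (Finset.univ.filter (BallCut xs)).Shatters A) : A.card ≤ d + 1 := by
  by_contra hcard
  have hdep : ¬ AffineIndependent ℝ (fun i : A => xs i) := by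
    intro hind
    have h1 := hind.card_le_finrank_succ
    have h2 := Submodule.finrank_le (vectorSpan ℝ (Set.range fun i : A => xs i))
    simp only [finrank_euclideanSpace, Fintype.card_coe, Fintype.card_fin] at h1 h2
    omega
  obtain ⟨I, z, hz1, hz2⟩ := Convex.radon_partition hdep
  obtain ⟨u, hu, hAu⟩ := hA (Finset.filter_subset (fun i => ∃ h : i ∈ A, (⟨i, h⟩ : A) ∈ I) A)
  obtain ⟨v, hv, hAv⟩ := hA (Finset.filter_subset (fun i => ∃ h : i ∈ A, (⟨i, h⟩ : A) ∉ I) A)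
  have mu : ∀ i : A, (i : Fin n) ∈ u ↔ i ∈ I := by
    intro i
    have := congrArg (fun s => (i : Fin n) ∈ s) hAu
    simpa using this
  have mv : ∀ i : A, (i : Fin n) ∈ v ↔ i ∉ I := by
    intro i
    have := congrArg (fun s => (i : Fin n) ∈ s) hAv
    simpa using this
  obtain ⟨-, c₁, t₁, ht₁, hin₁, hout₁⟩ := Finset.mem_filter.1 hu
  obtain ⟨-, c₂, t₂, ht₂, hin₂, hout₂⟩ := Finset.mem_filter.1 hv
  have hsq : ∀ c w : Eucl d, dist c w ^ 2 = ‖c‖ ^ 2 - 2 * inner ℝ c w + ‖w‖ ^ 2 := fun c w => by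
    rw [dist_eq_norm, norm_sub_sq_real]
  have hlin : IsLinearMap ℝ (fun w : Eucl d => inner ℝ (c₂ - c₁) w) :=
    ⟨fun x y => inner_add_right _ _ _, fun a x => inner_smul_right _ _ _⟩
  set b : ℝ := (t₁ ^ 2 - t₂ ^ 2 - ‖c₁‖ ^ 2 + ‖c₂‖ ^ 2) / 2 with hb
  have h1 : z ∈ {w : Eucl d | inner ℝ (c₂ - c₁) w < b} := by
    refine convexHull_min ?_ (convex_halfSpace_lt hlin b) hz1
    rintro _ ⟨i, hi, rfl⟩
    have e1 := hin₁ i ((mu i).2 hi)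
    have e2 := hout₂ i (fun h => (mv i).1 h hi)
    have e3 := pow_lt_pow_left₀ e1 dist_nonneg two_ne_zero
    have e4 := pow_lt_pow_left₀ e2 ht₂.le two_ne_zero
    rw [hsq] at e3 e4
    simp only [mem_ofPred_eq, inner_sub_left, hb]
    linarith
  have h2 : z ∈ {w : Eucl d | b < inner ℝ (c₂ - c₁) w} := by
    refine convexHull_min ?_ (convex_halfSpace_gt hlin b) hz2
    rintro _ ⟨i, hi, rfl⟩
    have e1 := hin₂ i ((mv i).2 hi)
    have e2 := hout₁ i (fun h => hi ((mu i).1 h))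
    have e3 := pow_lt_pow_left₀ e1 dist_nonneg two_ne_zero
    have e4 := pow_lt_pow_left₀ e2 ht₁.le two_ne_zero
    rw [hsq] at e3 e4
    simp only [mem_ofPred_eq, inner_sub_left, hb]
    linarith
  rw [mem_ofPred_eq] at h1 h2
  exact lt_asymm h1 h2

lemma card_powersetCard_le_pow (n m : ℕ) :
    (Finset.univ.filter fun A : Finset (Fin n) => A.card ≤ m).card ≤ (n + 1) ^ m := by
  have : (Finset.univ.filter fun A : Finset (Fin n) => A.card ≤ m) ⊆
      (Finset.univ : Finset (Fin m → Option (Fin n))).image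
        (fun f => Finset.univ.filter fun i => ∃ k, f k = some i) := by
    intro A hA
    have hA' : A.card ≤ m := by simpa using hA
    rw [Finset.mem_image]
    refine ⟨fun k => if hk : (k : ℕ) < A.card then some (A.equivFin.symm ⟨k, hk⟩ : Fin n)
      else none, Finset.mem_univ _, ?_⟩
    ext i
    simp only [Finset.mem_filter, Finset.mem_univ, true_and]
    constructor
    · rintro ⟨k, hk⟩
      split_ifs at hk with h
      simp only [Option.some.injEq] at hk
      rw [← hk]
      exact (A.equivFin.symm ⟨k, h⟩).2
    · intro hi
      refine ⟨⟨A.equivFin ⟨i, hi⟩, (A.equivFin ⟨i, hi⟩).2.trans_le hA'⟩, ?_⟩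
      simp
  refine (Finset.card_le_card this).trans (Finset.card_image_le.trans ?_)
  simp

lemma card_ballCut_le {d n : ℕ} (xs : Fin n → Eucl d) :
    (Finset.univ.filter (BallCut xs)).card ≤ (n + 1) ^ (d + 1) := by
  refine (Finset.card_le_card_shatterer _).trans
    ((Finset.card_le_card fun A hA => ?_).trans (card_powersetCard_le_pow n (d + 1)))
  rw [Finset.mem_shatterer] at hA
  simpa using card_le_of_shatters_ballCut xs hA

end Combinatorics

section WeightedSums

/-- A weighted sum with weights in `[0, M]` is an average of the sums over the superlevel sets
of the weights. -/
lemma weighted_sum_ge {ι : Type*} (s : Finset ι) (w a : ι → ℝ) {M L : ℝ} (hM : 0 ≤ M)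
    (hw0 : ∀ i ∈ s, 0 ≤ w i) (hwM : ∀ i ∈ s, w i ≤ M)
    (hL : ∀ β, 0 < β → -L ≤ ∑ i ∈ s with β ≤ w i, a i) :
    -(L * M) ≤ ∑ i ∈ s, w i * a i := by
  have hInt : ∀ i ∈ s, IntegrableOn ((Iic (w i)).indicator fun _ => a i) (Ioc 0 M) volume :=
    fun i _ => (integrableOn_const (by simp)).indicator measurableSet_Iic
  have h1 : ∑ i ∈ s, w i * a i =
      ∫ β in Ioc 0 M, ∑ i ∈ s, (Iic (w i)).indicator (fun _ => a i) β := by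
    rw [integral_finsetSum _ hInt]
    refine Finset.sum_congr rfl fun i hi => ?_
    rw [integral_indicator measurableSet_Iic, Measure.restrict_restrict measurableSet_Iic]
    have : Iic (w i) ∩ Ioc 0 M = Ioc 0 (w i) := by
      ext β
      simp only [mem_inter_iff, mem_Iic, mem_Ioc]
      constructor
      · rintro ⟨h1, h2, -⟩; exact ⟨h2, h1⟩
      · rintro ⟨h1, h2⟩; exact ⟨h2, h1, h2.trans (hwM i hi)⟩
    rw [this]
    simp [hw0 i hi]
  have h2 : -(L * M) = ∫ _β in Ioc (0:ℝ) M, -L := by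
    simp [hM]; ring
  rw [h1, h2]
  refine setIntegral_mono_on (integrableOn_const (by simp)) (integrable_finsetSum _ hInt)
    measurableSet_Ioc fun β hβ => ?_
  refine (hL β hβ.1).trans_eq ?_
  rw [Finset.sum_filter]
  refine Finset.sum_congr rfl fun i _ => ?_
  simp [indicator]

end WeightedSums

section Sampling

variable {E : Type*} [MeasurableSpace E]

lemma measurable_labelKernel {η : E → ℝ} (hη : Measurable η) :
    Measurable fun x : E => ENNReal.ofReal (η x) • Measure.dirac (x, true) +
      ENNReal.ofReal (1 - η x) • Measure.dirac (x, false) := by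
  refine Measure.measurable_of_measurable_coe _ fun s hs => ?_
  simp only [Measure.add_apply, Measure.smul_apply, smul_eq_mul, Measure.dirac_apply' _ hs]
  have h1 : ∀ b : Bool, Measurable fun x : E => s.indicator (1 : E × Bool → ℝ≥0∞) (x, b) :=
    fun b => (measurable_one.indicator hs).comp (by fun_prop)
  exact (hη.ennreal_ofReal.mul (h1 true)).add
    ((measurable_const.sub hη).ennreal_ofReal.mul (h1 false))

lemma jointD_apply (μ : Measure E) {η : E → ℝ} (hη : Measurable η) {s : Set (E × Bool)}
    (hs : MeasurableSet s) :
    jointD μ η s = ∫⁻ x, (ENNReal.ofReal (η x) * s.indicator 1 (x, true) +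
      ENNReal.ofReal (1 - η x) * s.indicator 1 (x, false)) ∂μ := by
  rw [jointD, Measure.bind_apply hs (measurable_labelKernel hη).aemeasurable]
  simp [Measure.dirac_apply' _ hs]

/-- For sets that need not be measurable, one inequality of `jointD_apply` survives. -/
lemma le_jointD (μ : Measure E) {η : E → ℝ} (hη : Measurable η) (s : Set (E × Bool)) :
    ∫⁻ x, (ENNReal.ofReal (η x) * s.indicator 1 (x, true) +
      ENNReal.ofReal (1 - η x) * s.indicator 1 (x, false)) ∂μ ≤ jointD μ η s := by
  rw [← measure_toMeasurable s, jointD_apply μ hη (measurableSet_toMeasurable _ s)]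
  refine lintegral_mono fun x => ?_
  gcongr <;> exact subset_toMeasurable _ _

lemma ofReal_add_ofReal_one_sub {p : ℝ} (hp : p ∈ Icc (0:ℝ) 1) :
    ENNReal.ofReal p + ENNReal.ofReal (1 - p) = 1 := by
  rw [← ENNReal.ofReal_add hp.1 (by linarith [hp.2])]
  simp

lemma jointD_fst_preimage (μ : Measure E) {η : E → ℝ} (hη : Measurable η)
    (hη01 : ∀ x, η x ∈ Icc (0:ℝ) 1) {B : Set E} (hB : MeasurableSet B) :
    jointD μ η (Prod.fst ⁻¹' B) = μ B := by
  rw [jointD_apply μ hη (measurable_fst hB), ← lintegral_indicator_one hB]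
  refine lintegral_congr fun x => ?_
  by_cases hx : x ∈ B <;> simp [indicator, hx, ofReal_add_ofReal_one_sub (hη01 x)]

lemma isProbabilityMeasure_jointD (μ : Measure E) [IsProbabilityMeasure μ] {η : E → ℝ}
    (hη : Measurable η) (hη01 : ∀ x, η x ∈ Icc (0:ℝ) 1) : IsProbabilityMeasure (jointD μ η) :=
  ⟨by simpa using jointD_fst_preimage μ hη hη01 MeasurableSet.univ⟩

/-- Labels generated by comparing an independent uniform variable with `η`. -/
noncomputable def thresholdLabel (η : E → ℝ) (p : E × ℝ) : E × Bool := (p.1, decide (p.2 ≤ η p.1))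

lemma measurable_thresholdLabel {η : E → ℝ} (hη : Measurable η) :
    Measurable (thresholdLabel η) := by
  refine measurable_fst.prodMk ?_
  refine measurable_to_bool ?_
  have : (fun p : E × ℝ => decide (p.2 ≤ η p.1)) ⁻¹' {true} = {p | p.2 ≤ η p.1} := by
    ext p; simp
  rw [this]
  exact measurableSet_le measurable_snd (hη.comp measurable_fst)

lemma lintegral_thresholdLabel {E : Type*} {η : E → ℝ} (x : E) (hx : η x ∈ Icc (0:ℝ) 1)
    (g : E × Bool → ℝ≥0∞) :
    ∫⁻ u in Icc (0:ℝ) 1, g (thresholdLabel η (x, u)) =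
      ENNReal.ofReal (η x) * g (x, true) + ENNReal.ofReal (1 - η x) * g (x, false) := by
  have hU : Icc (0:ℝ) 1 = Icc 0 (η x) ∪ Ioc (η x) 1 := (Icc_union_Ioc_eq_Icc hx.1 hx.2).symm
  have hd : Disjoint (Icc 0 (η x)) (Ioc (η x) 1) :=
    Set.disjoint_left.2 fun u h1 h2 => absurd h1.2 (not_le.2 h2.1)
  rw [hU, lintegral_union measurableSet_Ioc hd]
  congr 1
  · rw [setLIntegral_congr_fun (g := fun _ => g (x, true)) measurableSet_Icc
      fun u hu => by simp [thresholdLabel, hu.2]]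
    simp [mul_comm]
  · rw [setLIntegral_congr_fun (g := fun _ => g (x, false)) measurableSet_Ioc
      fun u hu => by simp [thresholdLabel, not_le.2 hu.1]]
    simp [mul_comm]

lemma jointD_eq_map (μ : Measure E) [SFinite μ] {η : E → ℝ} (hη : Measurable η)
    (hη01 : ∀ x, η x ∈ Icc (0:ℝ) 1) :
    jointD μ η = (μ.prod (volume.restrict (Icc (0:ℝ) 1))).map (thresholdLabel η) := by
  ext s hs
  have hφ := measurable_thresholdLabel hη
  have hc : Measurable fun p => s.indicator (1 : E × Bool → ℝ≥0∞) (thresholdLabel η p) :=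
    (measurable_one.indicator hs).comp hφ
  rw [jointD_apply μ hη hs, ← lintegral_indicator_one hs,
    lintegral_map (measurable_one.indicator hs) hφ, lintegral_prod _ hc.aemeasurable]
  exact lintegral_congr fun x => (lintegral_thresholdLabel x (hη01 x) _).symm

lemma lintegral_pi_prod {ι Z : Type*} [Fintype ι] [MeasurableSpace Z] (ν : ι → Measure Z)
    [∀ i, IsProbabilityMeasure (ν i)] (g : ι → Z → ℝ≥0∞) (hg : ∀ i, Measurable (g i)) :
    ∫⁻ z, ∏ i, g i (z i) ∂Measure.pi ν = ∏ i, ∫⁻ z, g i z ∂ν i := by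
  refine (ProbabilityTheory.lintegral_prod_eq_prod_lintegral_of_indepFun Finset.univ
    (fun i (z : ι → Z) => g i (z i))
    (ProbabilityTheory.iIndepFun_pi fun i => (hg i).aemeasurable)
    (fun i => (hg i).comp (measurable_pi_apply i))).trans ?_
  refine Finset.prod_congr rfl fun i _ => ?_
  exact (measurePreserving_eval ν i).lintegral_comp (hg i)

/-- An exponential-moment bound for the labels, conditionally on the instances. -/
lemma mul_sampleD_le (μ : Measure E) [IsProbabilityMeasure μ] {η : E → ℝ} (hη : Measurable η)
    (hη01 : ∀ x, η x ∈ Icc (0:ℝ) 1) {n : ℕ} {A : Set (Fin n → E)} (hA : MeasurableSet A)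
    (g : Fin n → E × Bool → ℝ≥0∞) (hg : ∀ i, Measurable (g i))
    (hgA : ∀ xs ∈ A, ∀ i, ENNReal.ofReal (η (xs i)) * g i (xs i, true) +
      ENNReal.ofReal (1 - η (xs i)) * g i (xs i, false) ≤ 1) (c : ℝ≥0∞) :
    c * sampleD μ η n {S | (fun i => (S i).1) ∈ A ∧ c ≤ ∏ i, g i (S i)} ≤
      Measure.pi (fun _ => μ) A := by
  have := isProbabilityMeasure_jointD μ hη hη01
  set U : Measure ℝ := volume.restrict (Icc (0:ℝ) 1) with hU
  have : IsProbabilityMeasure U := ⟨by simp [hU]⟩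
  have hφ := measurable_thresholdLabel hη
  set G : (Fin n → E × Bool) → ℝ≥0∞ := fun S =>
    A.indicator 1 (fun i => (S i).1) * ∏ i, g i (S i) with hG
  have hxs : Measurable fun S : Fin n → E × Bool => fun i => (S i).1 := by fun_prop
  have hGm : Measurable G := ((measurable_one.indicator hA).comp hxs).mul
    (Finset.measurable_prod _ fun i _ => (hg i).comp (measurable_pi_apply i))
  have h1 : {S : Fin n → E × Bool | (fun i => (S i).1) ∈ A ∧ c ≤ ∏ i, g i (S i)} ⊆
      {S | c ≤ G S} := by
    rintro S ⟨h1, h2⟩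
    simpa [hG, h1] using h2
  have hmap : sampleD μ η n = (((Measure.pi fun _ : Fin n => μ).prod
      (Measure.pi fun _ : Fin n => U)).map
      (MeasurableEquiv.arrowProdEquivProdArrow E ℝ (Fin n)).symm).map
      (fun z i => thresholdLabel η (z i)) := by
    rw [((measurePreserving_arrowProdEquivProdArrow E ℝ (Fin n) (fun _ => μ)
      (fun _ => U)).symm _).map_eq]
    rw [sampleD, jointD_eq_map μ hη hη01]
    have : IsProbabilityMeasure ((μ.prod U).map (thresholdLabel η)) :=
      Measure.isProbabilityMeasure_map hφ.aemeasurable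
    exact (Measure.pi_map_pi (fun _ => hφ.aemeasurable)).symm
  have hm1 : Measurable fun (z : Fin n → E × ℝ) i => thresholdLabel η (z i) := by fun_prop
  have hm2 : Measurable fun z : Fin n → E × ℝ => G fun i => thresholdLabel η (z i) :=
    hGm.comp hm1
  have hm3 : Measurable fun z : (Fin n → E) × (Fin n → ℝ) => G fun i => thresholdLabel η
      ((MeasurableEquiv.arrowProdEquivProdArrow E ℝ (Fin n)).symm z i) :=
    hm2.comp (MeasurableEquiv.measurable _)
  calc _ ≤ c * sampleD μ η n {S | c ≤ G S} := by gcongr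
    _ ≤ ∫⁻ S, G S ∂sampleD μ η n := mul_meas_ge_le_lintegral hGm c
    _ = ∫⁻ xs, ∫⁻ u, A.indicator 1 xs * ∏ i, g i (thresholdLabel η (xs i, u i))
          ∂(Measure.pi fun _ => U) ∂(Measure.pi fun _ => μ) := by
        rw [hmap, lintegral_map hGm hm1, lintegral_map hm2 (MeasurableEquiv.measurable _),
          lintegral_prod _ hm3.aemeasurable]
        rfl
    _ ≤ ∫⁻ xs, A.indicator 1 xs ∂(Measure.pi fun _ => μ) := by
        refine lintegral_mono fun xs => ?_
        by_cases hx : xs ∈ A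
        · simp only [indicator_of_mem hx, Pi.one_apply, one_mul]
          rw [lintegral_pi_prod (fun _ => U) (fun i u => g i (thresholdLabel η (xs i, u)))
            fun i => ((hg i).comp hφ).comp (by fun_prop)]
          refine Finset.prod_le_one' fun i _ => ?_
          rw [lintegral_thresholdLabel _ (hη01 _)]
          exact hgA xs hx i
        · simp [indicator_of_notMem hx]
    _ = _ := lintegral_indicator_one hA

end Sampling

section Concentration

variable {E : Type*} [MeasurableSpace E]

lemma exp_neg_le_quadratic {v : ℝ} (hv : |v| ≤ 1) : Real.exp (-v) ≤ 1 - v + v ^ 2 := by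
  have h := Real.abs_exp_sub_one_sub_id_le (x := -v) (by rwa [abs_neg])
  have := (abs_le.1 h).2
  nlinarith

lemma label_exp_moment_le_one {τ p Δ : ℝ} (hτ : τ = 1 ∨ τ = -1) (hp : p ∈ Icc (0:ℝ) 1)
    (hΔ : 0 < Δ) (h : 1 / 2 + Δ ≤ 1 / 2 + τ * (p - 1 / 2)) :
    p * Real.exp (-(Δ / 4 * (τ * labelVal true - Δ))) +
      (1 - p) * Real.exp (-(Δ / 4 * (τ * labelVal false - Δ))) ≤ 1 := by
  obtain ⟨hp0, hp1⟩ := hp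
  have key : ∀ q : ℝ, 0 ≤ q → q ≤ 1 → 1 / 2 + Δ ≤ q →
      q * Real.exp (-(Δ / 4 * (1 - Δ))) + (1 - q) * Real.exp (-(Δ / 4 * (-1 - Δ))) ≤ 1 := by
    intro q hq0 hq1 hq
    have hΔ' : Δ ≤ 1 / 2 := by linarith
    have e1 := exp_neg_le_quadratic (v := Δ / 4 * (1 - Δ)) (abs_le.2 ⟨by nlinarith, by nlinarith⟩)
    have e2 := exp_neg_le_quadratic (v := Δ / 4 * (-1 - Δ)) (abs_le.2 ⟨by nlinarith, by nlinarith⟩)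
    have e3 := mul_le_mul_of_nonneg_left e1 hq0
    have e4 := mul_le_mul_of_nonneg_left e2 (sub_nonneg.2 hq1)
    have e5 : 0 ≤ Δ * (q - (1 / 2 + Δ)) := by
      have := sub_nonneg.2 hq
      positivity
    have e6 : q * (Δ / 4 * (1 - Δ)) ^ 2 + (1 - q) * (Δ / 4 * (-1 - Δ)) ^ 2 ≤ Δ ^ 2 / 4 := by
      have f1 : (Δ / 4 * (1 - Δ)) ^ 2 ≤ Δ ^ 2 / 4 := by nlinarith [sq_nonneg Δ]
      have f2 : (Δ / 4 * (-1 - Δ)) ^ 2 ≤ Δ ^ 2 / 4 := by nlinarith [sq_nonneg Δ]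
      nlinarith
    nlinarith
  rcases hτ with rfl | rfl
  · have := key p hp0 hp1 (by linarith)
    simpa [labelVal] using this
  · have := key (1 - p) (by linarith) (by linarith) (by linarith)
    simp only [labelVal] at this ⊢
    norm_num at this ⊢
    linarith

/-- With high probability, labels with bias at least `2Δ` have average at least `Δ` over every
set of sample points cut out by a ball, up to an additive error `L`. -/
lemma sampleD_ballCut_deviation_le {d n : ℕ} (μ : Measure (Eucl d)) [IsProbabilityMeasure μ]
    {η : Eucl d → ℝ} (hη : Measurable η) (hη01 : ∀ x, η x ∈ Icc (0:ℝ) 1) {τ Δ : ℝ}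
    (hτ : τ = 1 ∨ τ = -1) (hΔ : 0 < Δ) (L : ℝ) :
    sampleD μ η n {S | ∃ T, BallCut (fun i => (S i).1) T ∧
      (∀ i ∈ T, 1 / 2 + Δ ≤ 1 / 2 + τ * (η (S i).1 - 1 / 2)) ∧
      ∑ i ∈ T, (τ * labelVal (S i).2 - Δ) < -L} ≤
    ENNReal.ofReal (((n:ℝ) + 1) ^ (d + 1) * Real.exp (-(Δ / 4 * L))) := by
  set A : Finset (Fin n) → Set (Fin n → Eucl d) := fun T =>
    {xs | BallCut xs T} ∩ ⋂ i ∈ T, {xs | 1 / 2 + Δ ≤ 1 / 2 + τ * (η (xs i) - 1 / 2)} with hA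
  have hAm : ∀ T, MeasurableSet (A T) := fun T => (isOpen_ballCut T).measurableSet.inter <|
    Finset.measurableSet_biInter _ fun i _ => measurableSet_le measurable_const (by fun_prop)
  set g : Finset (Fin n) → Fin n → Eucl d × Bool → ℝ≥0∞ := fun T i z =>
    if i ∈ T then ENNReal.ofReal (Real.exp (-(Δ / 4 * (τ * labelVal z.2 - Δ)))) else 1 with hg
  have hlab : Measurable labelVal := measurable_of_countable _
  have hgm : ∀ T i, Measurable (g T i) := by
    intro T i
    by_cases hi : i ∈ T
    · simp only [hg, hi, if_true]
      fun_prop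
    · simp only [hg, hi, if_false]
      fun_prop
  set c : ℝ≥0∞ := ENNReal.ofReal (Real.exp (Δ / 4 * L)) with hc
  have hc0 : c ≠ 0 := by simp [hc, Real.exp_pos]
  have hcT : c ≠ ⊤ := ENNReal.ofReal_ne_top
  set N : ℝ≥0∞ := (((n + 1) ^ (d + 1) : ℕ) : ℝ≥0∞) with hN
  have hsub : {S : Fin n → Eucl d × Bool | ∃ T, BallCut (fun i => (S i).1) T ∧
      (∀ i ∈ T, 1 / 2 + Δ ≤ 1 / 2 + τ * (η (S i).1 - 1 / 2)) ∧
      ∑ i ∈ T, (τ * labelVal (S i).2 - Δ) < -L} ⊆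
      ⋃ T ∈ (Finset.univ : Finset (Finset (Fin n))),
        {S | (fun i => (S i).1) ∈ A T ∧ c ≤ ∏ i, g T i (S i)} := by
    rintro S ⟨T, h1, h2, h3⟩
    simp only [mem_iUnion]
    refine ⟨T, Finset.mem_univ _, ⟨h1, by simpa using h2⟩, ?_⟩
    have : ∏ i, g T i (S i) =
        ENNReal.ofReal (Real.exp (-(Δ / 4 * ∑ i ∈ T, (τ * labelVal (S i).2 - Δ)))) := by
      simp only [hg, Finset.prod_ite_mem, Finset.univ_inter]
      rw [Finset.mul_sum, ← Finset.sum_neg_distrib, Real.exp_sum,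
        ENNReal.ofReal_prod_of_nonneg fun i _ => (Real.exp_pos _).le]
    rw [this, hc]
    refine ENNReal.ofReal_le_ofReal (Real.exp_le_exp.2 ?_)
    nlinarith
  have hT : ∀ T, c * sampleD μ η n {S | (fun i => (S i).1) ∈ A T ∧ c ≤ ∏ i, g T i (S i)} ≤
      Measure.pi (fun _ => μ) (A T) := by
    intro T
    refine mul_sampleD_le μ hη hη01 (hAm T) (g T) (hgm T) ?_ c
    rintro xs ⟨-, hxs⟩ i
    by_cases hi : i ∈ T
    · have hxi : 1 / 2 + Δ ≤ 1 / 2 + τ * (η (xs i) - 1 / 2) := by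
        simp only [mem_iInter] at hxs
        exact hxs i hi
      obtain ⟨h0, h1⟩ := hη01 (xs i)
      simp only [hg, hi, if_true]
      rw [← ENNReal.ofReal_mul h0, ← ENNReal.ofReal_mul (by linarith), ← ENNReal.ofReal_add
        (by positivity) (mul_nonneg (by linarith) (Real.exp_pos _).le)]
      exact ENNReal.ofReal_le_one.2 (label_exp_moment_le_one hτ (hη01 _) hΔ hxi)
    · simp only [hg, hi, if_false, mul_one]
      exact (ofReal_add_ofReal_one_sub (hη01 _)).le
  have hsum : ∑ T, Measure.pi (fun _ : Fin n => μ) (A T) ≤ N := by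
    calc ∑ T, Measure.pi (fun _ : Fin n => μ) (A T)
        = ∫⁻ xs, ∑ T, (A T).indicator 1 xs ∂Measure.pi (fun _ : Fin n => μ) := by
          rw [lintegral_finsetSum _ fun T _ => measurable_one.indicator (hAm T)]
          exact Finset.sum_congr rfl fun T _ => (lintegral_indicator_one (hAm T)).symm
      _ ≤ ∫⁻ _, N ∂Measure.pi (fun _ : Fin n => μ) := by
          refine lintegral_mono fun xs => ?_
          calc ∑ T, (A T).indicator (1 : (Fin n → Eucl d) → ℝ≥0∞) xs
              ≤ ∑ T, if BallCut xs T then 1 else 0 := by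
                refine Finset.sum_le_sum fun T _ => ?_
                by_cases hx : xs ∈ A T
                · have : BallCut xs T := hx.1
                  simp [hx, this]
                · simp [hx]
            _ = ((Finset.univ.filter (BallCut xs)).card : ℝ≥0∞) := by simp
            _ ≤ N := Nat.cast_le.2 (card_ballCut_le xs)
      _ = N := by simp
  refine (measure_mono hsub).trans ((measure_biUnion_finset_le _ _).trans ?_)
  have h1 : c * ∑ T, sampleD μ η n {S | (fun i => (S i).1) ∈ A T ∧ c ≤ ∏ i, g T i (S i)} ≤ N := by
    rw [Finset.mul_sum]
    exact (Finset.sum_le_sum fun T _ => hT T).trans hsum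
  have h2 := (ENNReal.le_div_iff_mul_le (Or.inl hc0) (Or.inl hcT)).2 ((mul_comm _ _).trans_le h1)
  refine h2.trans_eq ?_
  rw [ENNReal.ofReal_mul (by positivity), Real.exp_neg, ENNReal.ofReal_inv_of_pos (Real.exp_pos _),
    div_eq_mul_inv]
  congr 1
  rw [hN, ← ENNReal.ofReal_natCast]
  push_cast
  rfl

/-- With high probability, a set of mass at least `p` contains at least `n * p / 2` of the
sample points. -/
lemma sampleD_count_le (μ : Measure E) [IsProbabilityMeasure μ] {η : E → ℝ} (hη : Measurable η)
    (hη01 : ∀ x, η x ∈ Icc (0:ℝ) 1) (n : ℕ) {B : Set E} (hB : MeasurableSet B) {p : ℝ}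
    (hp : p ≤ μ.real B) :
    sampleD μ η n {S | ((Finset.univ.filter fun i => (S i).1 ∈ B).card : ℝ) < n * (p / 2)} ≤
      ENNReal.ofReal (Real.exp (-(p / 16 * n))) := by
  have := isProbabilityMeasure_jointD μ hη hη01
  set a : ℝ := Real.exp (3 * p / 16 - 1 / 4) with ha
  set b : ℝ := Real.exp (3 * p / 16) with hb
  set g : E × Bool → ℝ≥0∞ := fun z => ENNReal.ofReal (if z.1 ∈ B then a else b) with hg
  have hgm : Measurable g := (Measurable.ite (measurable_fst hB) measurable_const
    measurable_const).ennreal_ofReal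
  have hInt : ∫⁻ z, g z ∂jointD μ η ≤ 1 := by
    have hB' : MeasurableSet (Prod.fst ⁻¹' B : Set (E × Bool)) := measurable_fst hB
    rw [← lintegral_add_compl g hB',
      setLIntegral_congr_fun (g := fun _ => ENNReal.ofReal a) hB' fun z hz => by
        have hz' : z.1 ∈ B := hz
        simp [hg, hz'],
      setLIntegral_congr_fun (g := fun _ => ENNReal.ofReal b) hB'.compl fun z hz => by
        have hz' : z.1 ∉ B := hz
        simp [hg, hz']]
    rw [setLIntegral_const, setLIntegral_const, ← preimage_compl,
      jointD_fst_preimage μ hη hη01 hB, jointD_fst_preimage μ hη hη01 hB.compl,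
      ← ofReal_measureReal, ← ofReal_measureReal, ← ENNReal.ofReal_mul (Real.exp_pos _).le,
      ← ENNReal.ofReal_mul (Real.exp_pos _).le, ← ENNReal.ofReal_add (by positivity)
      (by positivity), measureReal_compl hB]
    refine ENNReal.ofReal_le_one.2 ?_
    simp only [probReal_univ]
    have e1 := exp_neg_le_quadratic (v := 1 / 4) (by norm_num [abs_le])
    have e2 : a = b * Real.exp (-(1 / 4)) := by rw [ha, hb, ← Real.exp_add]; ring_nf
    have e3 : 1 - 3 * p / 16 ≤ Real.exp (-(3 * p / 16)) := by
      linarith [Real.add_one_le_exp (-(3 * p / 16))]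
    have e4 : b * Real.exp (-(3 * p / 16)) = 1 := by rw [hb, ← Real.exp_add]; simp
    have hb0 : 0 < b := Real.exp_pos _
    have hq : 0 ≤ μ.real B := measureReal_nonneg
    calc a * μ.real B + b * (1 - μ.real B)
        = b * (1 - μ.real B * (1 - Real.exp (-(1 / 4)))) := by rw [e2]; ring
      _ ≤ b * Real.exp (-(3 * p / 16)) := by
          refine mul_le_mul_of_nonneg_left (le_trans ?_ e3) hb0.le
          nlinarith
      _ = 1 := e4
  set c : ℝ≥0∞ := ENNReal.ofReal (Real.exp (p / 16 * n)) with hc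
  have hc0 : c ≠ 0 := by simp [hc, Real.exp_pos]
  have hcT : c ≠ ⊤ := ENNReal.ofReal_ne_top
  have hsub : {S : Fin n → E × Bool |
      ((Finset.univ.filter fun i => (S i).1 ∈ B).card : ℝ) < n * (p / 2)} ⊆
      {S | c ≤ ∏ i, g (S i)} := by
    intro S hS
    rw [mem_ofPred_eq] at hS ⊢
    have h1 : ∏ i, g (S i) = ENNReal.ofReal (Real.exp
        (∑ i, (3 * p / 16 - (1 / 4) * if (S i).1 ∈ B then 1 else 0))) := by
      rw [Real.exp_sum, ENNReal.ofReal_prod_of_nonneg fun i _ => (Real.exp_pos _).le]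
      refine Finset.prod_congr rfl fun i _ => ?_
      by_cases hi : (S i).1 ∈ B <;> simp [hg, hi, ha, hb]
    rw [h1, hc]
    refine ENNReal.ofReal_le_ofReal (Real.exp_le_exp.2 ?_)
    rw [Finset.sum_sub_distrib, ← Finset.mul_sum, Finset.sum_boole]
    simp only [Finset.sum_const, Finset.card_univ, Fintype.card_fin, nsmul_eq_mul]
    linarith
  have hprod : Measurable fun S : Fin n → E × Bool => ∏ i, g (S i) :=
    Finset.measurable_prod _ fun i _ => hgm.comp (measurable_pi_apply i)
  have h1 : c * sampleD μ η n {S | c ≤ ∏ i, g (S i)} ≤ 1 := by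
    refine (mul_meas_ge_le_lintegral hprod c).trans ?_
    rw [sampleD, lintegral_pi_prod _ (fun _ => g) fun _ => hgm]
    exact Finset.prod_le_one' fun i _ => hInt
  refine (measure_mono hsub).trans ?_
  have h2 := (ENNReal.le_div_iff_mul_le (Or.inl hc0) (Or.inl hcT)).2 ((mul_comm _ _).trans_le h1)
  refine h2.trans_eq ?_
  rw [Real.exp_neg, ENNReal.ofReal_inv_of_pos (Real.exp_pos _), one_div]

lemma msupport_mem_ae {d : ℕ} (μ : Measure (Eucl d)) : μ (msupport μ)ᶜ = 0 := by
  have : msupport μ = μ.support := by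
    ext x
    exact nhds_basis_ball.mem_measureSupport.symm
  rw [this]
  exact Measure.support_mem_ae

lemma sampleD_exists_notMem_msupport {d : ℕ} (μ : Measure (Eucl d)) [IsProbabilityMeasure μ]
    {η : Eucl d → ℝ} (hη : Measurable η) (hη01 : ∀ x, η x ∈ Icc (0:ℝ) 1) (n : ℕ) :
    sampleD μ η n {S | ∃ i, (S i).1 ∉ msupport μ} = 0 := by
  have := isProbabilityMeasure_jointD μ hη hη01
  have h1 : {S : Fin n → Eucl d × Bool | ∃ i, (S i).1 ∉ msupport μ} =
      ⋃ i, (Function.eval i) ⁻¹' (Prod.fst ⁻¹' (msupport μ)ᶜ) := by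
    ext S; simp
  rw [h1, measure_iUnion_null_iff]
  intro i
  refine (measurePreserving_eval (fun _ : Fin n => jointD μ η) i).quasiMeasurePreserving.preimage_null ?_
  obtain ⟨B, hB1, hB2, hB3⟩ := exists_measurable_superset_of_null (msupport_mem_ae μ)
  exact measure_mono_null (preimage_mono hB1) (by rw [jointD_fst_preimage μ hη hη01 hB2, hB3])

end Concentration

section KernelVote

/-- A kernel vote at `x'` is positive if the points in the ball of radius `r₂` have biased labels,
there are enough points in the smaller ball of radius `r₁`, and the weights at distances beyond
`r₂` are negligible. -/
lemma kernel_vote_pos {E : Type*} [MetricSpace E] {n : ℕ} {K : ℝ → ℝ} {h : ℝ} (hh : 0 < h)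
    (hK0 : ∀ x : ℝ, 0 ≤ x → 0 ≤ K x) (hKdec : AntitoneOn K (Ici 0))
    (xs : Fin n → E) (s : Fin n → ℝ) (hs : ∀ i, |s i| ≤ 1) {Δ L m r₁ r₂ : ℝ} (hΔ : 0 < Δ)
    (hL : 0 ≤ L) (hr₁ : 0 < r₁) (hr : r₁ < r₂) (x' : E)
    (hdev : ∀ T, BallCut xs T → (∀ i ∈ T, dist x' (xs i) ≤ r₂) → -L ≤ ∑ i ∈ T, (s i - Δ))
    (hcount : m ≤ ((Finset.univ.filter fun i => dist x' (xs i) ≤ r₁).card : ℝ))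
    (hnum : L * K 0 + n * K (r₂ / h) < Δ * (m * K (r₁ / h))) :
    0 < ∑ i, K (dist x' (xs i) / h) * s i := by
  set w : Fin n → ℝ := fun i => K (dist x' (xs i) / h) with hw
  have hd : ∀ i, 0 ≤ dist x' (xs i) / h := fun i => div_nonneg dist_nonneg hh.le
  have hw0 : ∀ i, 0 ≤ w i := fun i => hK0 _ (hd i)
  have hK : ∀ {a b : ℝ}, 0 ≤ a → a ≤ b → K (b / h) ≤ K (a / h) := fun {a b} ha hab =>
    hKdec (div_nonneg ha hh.le) (div_nonneg (ha.trans hab) hh.le) (by gcongr)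
  set near := Finset.univ.filter fun i => dist x' (xs i) ≤ r₂ with hnear
  have h1 : -(L * K 0) ≤ ∑ i ∈ near, w i * (s i - Δ) := by
    refine weighted_sum_ge near w _ (hK0 0 le_rfl) (fun i _ => hw0 i)
      (fun i _ => hKdec self_mem_Ici (hd i) (hd i)) fun β _ => ?_
    rcases (near.filter fun i => β ≤ w i).eq_empty_or_nonempty with he | hne
    · rw [he]; simpa using hL
    · obtain ⟨j, hj, hmax⟩ := Finset.exists_max_image _ (fun i => dist x' (xs i)) hne
      have hj' : dist x' (xs j) ≤ r₂ ∧ β ≤ w j := by simpa [hnear] using hj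
      have heq : (near.filter fun i => β ≤ w i) =
          Finset.univ.filter fun i => dist x' (xs i) ≤ dist x' (xs j) := by
        ext i
        simp only [Finset.mem_filter, Finset.mem_univ, true_and]
        constructor
        · intro hi
          exact hmax i (Finset.mem_filter.2 hi)
        · intro hi
          exact ⟨by simpa [hnear] using hi.trans hj'.1, hj'.2.trans (hK dist_nonneg hi)⟩
      rw [heq]
      refine hdev _ (ballCut_closedBall xs x' dist_nonneg) fun i hi => ?_
      simp only [Finset.mem_filter, Finset.mem_univ, true_and] at hi
      exact hi.trans hj'.1
  have h2 : m * K (r₁ / h) ≤ ∑ i ∈ near, w i := by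
    calc m * K (r₁ / h)
        ≤ ((Finset.univ.filter fun i => dist x' (xs i) ≤ r₁).card : ℝ) * K (r₁ / h) :=
          mul_le_mul_of_nonneg_right hcount (hK0 _ (div_nonneg hr₁.le hh.le))
      _ = ∑ i with dist x' (xs i) ≤ r₁, K (r₁ / h) := by simp
      _ ≤ ∑ i with dist x' (xs i) ≤ r₁, w i := by
          refine Finset.sum_le_sum fun i hi => ?_
          simp only [Finset.mem_filter, Finset.mem_univ, true_and] at hi
          exact hK dist_nonneg hi
      _ ≤ ∑ i ∈ near, w i := by
          refine Finset.sum_le_sum_of_subset_of_nonneg (fun i hi => ?_) fun i _ _ => hw0 i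
          simp only [hnear, Finset.mem_filter, Finset.mem_univ, true_and] at hi ⊢
          exact hi.trans hr.le
  have h3 : -(n * K (r₂ / h)) ≤ ∑ i with ¬ dist x' (xs i) ≤ r₂, w i * s i := by
    have hKr : 0 ≤ K (r₂ / h) := hK0 _ (div_nonneg (hr₁.trans hr).le hh.le)
    calc -(n * K (r₂ / h)) ≤ ∑ i with ¬ dist x' (xs i) ≤ r₂, -K (r₂ / h) := by
          rw [Finset.sum_const, nsmul_eq_mul, mul_neg, neg_le_neg_iff]
          refine mul_le_mul_of_nonneg_right ?_ hKr
          exact_mod_cast (Finset.card_le_univ _).trans_eq (Fintype.card_fin n)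
      _ ≤ _ := by
          refine Finset.sum_le_sum fun i hi => ?_
          simp only [Finset.mem_filter, Finset.mem_univ, true_and, not_le] at hi
          have e1 : w i ≤ K (r₂ / h) := hK (hr₁.trans hr).le hi.le
          have e2 := (abs_le.1 (hs i)).1
          nlinarith [hw0 i]
  have h4 : ∑ i ∈ near, w i * (s i - Δ) = ∑ i ∈ near, w i * s i - Δ * ∑ i ∈ near, w i := by
    rw [Finset.mul_sum, ← Finset.sum_sub_distrib]
    exact Finset.sum_congr rfl fun i _ => by ring
  have h5 := Finset.sum_filter_add_sum_filter_not Finset.univ (fun i => dist x' (xs i) ≤ r₂)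
    (fun i => w i * s i)
  have h6 := mul_le_mul_of_nonneg_left h2 hΔ.le
  rw [← h5]
  linarith

lemma kernel_pos {K : ℝ → ℝ} {h : ℕ → ℝ} (hpos : ∀ n, 0 < h n)
    (hKdec : AntitoneOn K (Ici 0)) (hh0 : Tendsto h atTop (nhds 0))
    (hK4 : ∀ x : ℝ, 0 ≤ x →
      Tendsto (fun n : ℕ => (n : ℝ) / Real.log n * K (x / h n)) atTop atTop)
    {x : ℝ} (hx : 0 ≤ x) : 0 < K x := by
  have h1 : ∀ᶠ n in atTop, h n * x < 1 := by
    have : Tendsto (fun n => h n * x) atTop (nhds 0) := by simpa using hh0.mul_const x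
    exact this.eventually_lt_const one_pos
  obtain ⟨n, h1, h2, h3⟩ := (h1.and (((hK4 1 zero_le_one).eventually_gt_atTop 0).and
    (eventually_ge_atTop 2))).exists
  have h4 : 0 ≤ (n:ℝ) / Real.log n := div_nonneg n.cast_nonneg (Real.log_natCast_nonneg n)
  have h5 : 0 < K (1 / h n) := pos_of_mul_pos_right h2 h4
  refine h5.trans_le (hKdec hx (one_div_nonneg.2 (hpos n).le) ?_)
  rw [le_div_iff₀ (hpos n)]
  linarith

/-- The asymptotic comparison of kernel weights that makes `kernel_vote_pos` applicable. -/
lemma eventually_kernel_lt {K : ℝ → ℝ} {h : ℕ → ℝ} (hpos : ∀ n, 0 < h n)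
    (hKdec : AntitoneOn K (Ici 0)) (hh0 : Tendsto h atTop (nhds 0))
    (hratio : ∀ c > (1:ℝ), Tendsto (fun x => K (c * x) / K x) atTop (nhds 0))
    (hK4 : ∀ x : ℝ, 0 ≤ x →
      Tendsto (fun n : ℕ => (n : ℝ) / Real.log n * K (x / h n)) atTop atTop)
    {a R c b C : ℝ} (ha : 0 < a) (hR : 0 ≤ R) (hc : 1 < c) (hb : 0 < b) :
    ∀ᶠ n : ℕ in atTop, ∀ r, a ≤ r → r ≤ R →
      C * Real.log n * K 0 + n * K (c * r / h n) < b * (n * K (r / h n)) := by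
  have hKp : ∀ {x : ℝ}, 0 ≤ x → 0 < K x := fun hx => kernel_pos hpos hKdec hh0 hK4 hx
  obtain ⟨X, hX⟩ := eventually_atTop.1 ((hratio c hc).eventually_lt_const (half_pos hb))
  have h1 : ∀ᶠ n in atTop, h n * X < a := by
    have : Tendsto (fun n => h n * X) atTop (nhds 0) := by simpa using hh0.mul_const X
    exact this.eventually_lt_const ha
  filter_upwards [h1, (hK4 R hR).eventually_ge_atTop (C * K 0 * (2 / b)), eventually_ge_atTop 2]
    with n h1 h2 h3 r har hrR
  have hr : 0 < r := ha.trans_le har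
  have hn : (0:ℝ) < n := by positivity
  have hlog : 0 < Real.log n := Real.log_pos (by exact_mod_cast h3)
  have hrh : 0 < r / h n := div_pos hr (hpos n)
  have e1 : K (c * r / h n) < b / 2 * K (r / h n) := by
    have := hX (r / h n) (by rw [le_div_iff₀ (hpos n)]; linarith)
    rwa [div_lt_iff₀ (hKp hrh.le), ← mul_div_assoc] at this
  have e2 : K (R / h n) ≤ K (r / h n) :=
    hKdec hrh.le (div_nonneg hR (hpos n).le) (div_le_div_of_nonneg_right hrR (hpos n).le)
  have e3 : C * Real.log n * K 0 ≤ b / 2 * (n * K (R / h n)) := by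
    rw [div_mul_eq_mul_div, le_div_iff₀ hlog] at h2
    have h4 : C * K 0 * (2 / b) * Real.log n * (b / 2) = C * Real.log n * K 0 := by
      field_simp
    rw [← h4, mul_comm (b / 2)]
    exact mul_le_mul_of_nonneg_right h2 (half_pos hb).le
  have e4 := mul_lt_mul_of_pos_left e1 hn
  have e5 := mul_le_mul_of_nonneg_left e2 (mul_pos (half_pos hb) hn).le
  linarith

end KernelVote

section OneSided

lemma exists_measure_infDist_lt_le {E : Type*} [MetricSpace E] [MeasurableSpace E]
    [OpensMeasurableSpace E] (μ : Measure E) [IsFiniteMeasure μ] (Z : Set E) {ε : ℝ}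
    (hε : 0 < ε) :
    ∃ s > 0, μ {x | 0 < infDist x Z ∧ infDist x Z < s} ≤ ENNReal.ofReal ε := by
  have hm : ∀ k : ℕ, MeasurableSet {x | 0 < infDist x Z ∧ infDist x Z < 1 / ((k:ℝ) + 1)} :=
    fun k => (measurableSet_lt measurable_const (continuous_infDist_pt Z).measurable).inter
      (measurableSet_lt (continuous_infDist_pt Z).measurable measurable_const)
  have hanti : Antitone fun k : ℕ => {x | 0 < infDist x Z ∧ infDist x Z < 1 / ((k:ℝ) + 1)} := by
    intro k l hkl x hx
    exact ⟨hx.1, hx.2.trans_le (by gcongr)⟩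
  have hlim := tendsto_measure_iInter_atTop (μ := μ) (fun k => (hm k).nullMeasurableSet) hanti
    ⟨0, measure_ne_top _ _⟩
  have hempty : ⋂ k : ℕ, {x | 0 < infDist x Z ∧ infDist x Z < 1 / ((k:ℝ) + 1)} = ∅ := by
    rw [eq_empty_iff_forall_notMem]
    intro x hx
    rw [mem_iInter] at hx
    obtain ⟨k, hk⟩ := exists_nat_one_div_lt (hx 0).1
    exact lt_asymm hk (hx k).2
  rw [hempty, measure_empty] at hlim
  obtain ⟨k, hk⟩ := (hlim.eventually_le_const (ENNReal.ofReal_pos.2 hε)).exists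
  exact ⟨_, by positivity, hk⟩

/-- The points of the bias-positive region at which the (signed) kernel vote is not positive on
the whole robustness region. -/
def nonrobustSet {E : Type*} [MetricSpace E] (K : ℝ → ℝ) (h : ℝ) (ζ : E → ℝ) (τ κ : ℝ) {n : ℕ}
    (S : Fin n → E × Bool) : Set E :=
  {x | 1 / 2 < ζ x ∧ ¬ ∀ x', dist x x' < κ * infDist x' {z | ζ z ≤ 1 / 2} →
    0 < ∑ i, K (dist x' (S i).1 / h) * (τ * labelVal (S i).2)}

lemma tendsto_ballCut_bound (d : ℕ) {Δ : ℝ} (hΔ : 0 < Δ) :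
    Tendsto (fun n : ℕ => ENNReal.ofReal (((n:ℝ) + 1) ^ (d + 1) *
      Real.exp (-(Δ / 4 * (4 * (d + 2) / Δ * Real.log n))))) atTop (nhds 0) := by
  have h1 : Tendsto (fun n : ℕ => (2:ℝ) ^ (d + 1) * (n:ℝ)⁻¹) atTop (nhds 0) := by
    simpa using (tendsto_inv_atTop_nhds_zero_nat (𝕜 := ℝ)).const_mul ((2:ℝ) ^ (d + 1))
  have h2 : Tendsto (fun n : ℕ => ((n:ℝ) + 1) ^ (d + 1) *
      Real.exp (-(Δ / 4 * (4 * (d + 2) / Δ * Real.log n)))) atTop (nhds 0) := by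
    refine squeeze_zero' (Eventually.of_forall fun n => by positivity) ?_ h1
    filter_upwards [eventually_ge_atTop 1] with n hn
    have hn' : (1:ℝ) ≤ n := by exact_mod_cast hn
    have hn0 : (0:ℝ) < n := by linarith
    have e1 : Real.exp (-(Δ / 4 * (4 * (d + 2) / Δ * Real.log n))) = ((n:ℝ) ^ (d + 2))⁻¹ := by
      have : Δ / 4 * (4 * (d + 2) / Δ * Real.log n) = ((d + 2 : ℕ) : ℝ) * Real.log n := by
        push_cast
        field_simp
      rw [this, Real.exp_neg, Real.exp_nat_mul, Real.exp_log hn0]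
    rw [e1]
    calc ((n:ℝ) + 1) ^ (d + 1) * ((n:ℝ) ^ (d + 2))⁻¹
        ≤ (2 * (n:ℝ)) ^ (d + 1) * ((n:ℝ) ^ (d + 2))⁻¹ := by gcongr; linarith
      _ = 2 ^ (d + 1) * (n:ℝ)⁻¹ := by
          rw [mul_pow, pow_succ (n:ℝ) (d + 1)]
          field_simp
  simpa using ENNReal.tendsto_ofReal h2

/-- With high probability the kernel vote is robustly correct on all but a small part of the
region where the label `τ` is more likely than not. -/
lemma eventually_sampleD_nonrobustSet_le {d : ℕ} {K : ℝ → ℝ} {h : ℕ → ℝ} (hpos : ∀ n, 0 < h n)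
    (hK0 : ∀ x : ℝ, 0 ≤ x → 0 ≤ K x) (hKdec : AntitoneOn K (Ici 0))
    (hh0 : Tendsto h atTop (nhds 0))
    (hratio : ∀ c > (1:ℝ), Tendsto (fun x => K (c * x) / K x) atTop (nhds 0))
    (hK4 : ∀ x : ℝ, 0 ≤ x →
      Tendsto (fun n : ℕ => (n : ℝ) / Real.log n * K (x / h n)) atTop atTop)
    (μ : Measure (Eucl d)) [IsProbabilityMeasure μ] {η : Eucl d → ℝ}
    (hηc : Continuous η) (hη01 : ∀ x, η x ∈ Icc (0:ℝ) 1) {τ : ℝ} (hτ : τ = 1 ∨ τ = -1)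
    {ζ : Eucl d → ℝ} (hζ : ∀ x, ζ x = 1 / 2 + τ * (η x - 1 / 2))
    {κ : ℝ} (hκ : κ ∈ Ioo (0:ℝ) 1) {X : Set (Eucl d)} (hXc : IsCompact X)
    (hX : ∀ x ∈ msupport μ, 1 / 2 < ζ x →
      ∀ x', dist x x' < κ * infDist x' {z | ζ z ≤ 1 / 2} → x' ∈ X)
    {ε δ : ℝ} (hε : 0 < ε) (hδ : 0 < δ) :
    ∀ᶠ n : ℕ in atTop, sampleD μ η n
      {S | ¬ μ (nonrobustSet K (h n) ζ τ κ S) ≤ ENNReal.ofReal ε} ≤ ENNReal.ofReal δ := by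
  obtain ⟨hκ0, hκ1⟩ := hκ
  have hηm := hηc.measurable
  have hζc : Continuous ζ := by
    rw [show ζ = fun x => 1 / 2 + τ * (η x - 1 / 2) from funext hζ]
    fun_prop
  set Z : Set (Eucl d) := {z | ζ z ≤ 1 / 2} with hZ
  have hZc : IsClosed Z := isClosed_le hζc continuous_const
  rcases Z.eq_empty_or_nonempty with hZe | hZn
  · refine Eventually.of_forall fun n => ?_
    have : ∀ S : Fin n → Eucl d × Bool, nonrobustSet K (h n) ζ τ κ S = ∅ := by
      intro S
      rw [eq_empty_iff_forall_notMem]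
      rintro x ⟨-, hx⟩
      refine hx fun x' hx' => ?_
      rw [← hZ, hZe, infDist_empty, mul_zero] at hx'
      exact absurd hx' (not_lt.2 dist_nonneg)
    simp [this]
  set D : Eucl d → ℝ := fun x => infDist x Z with hD
  have hDc : Continuous D := continuous_infDist_pt Z
  have hDlip : ∀ x y, D x ≤ D y + dist x y := fun x y => infDist_le_infDist_add_dist
  have hDpos : ∀ x, 1 / 2 < ζ x ↔ 0 < D x := fun x => by
    rw [hD, ← hZc.notMem_iff_infDist_pos hZn, hZ, mem_ofPred_eq, not_le]
  have hself : ∀ x ∈ msupport μ, 1 / 2 < ζ x → x ∈ X := fun x hx hx' =>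
    hX x hx hx' x (by rw [dist_self]; exact mul_pos hκ0 ((hDpos x).1 hx'))
  obtain ⟨s, hs, hμs⟩ := exists_measure_infDist_lt_le μ Z hε
  obtain ⟨R, hR⟩ := hXc.exists_bound_of_continuousOn hDc.continuousOn
  set κ₁ : ℝ := κ + (1 - κ) / 3 with hκ₁
  set κ₂ : ℝ := κ + 2 * (1 - κ) / 3 with hκ₂
  set s' : ℝ := (1 - κ₂) * (s / 2) with hs'
  have hs'0 : 0 < s' := mul_pos (by linarith) (by linarith)
  obtain ⟨Δ, hΔ, hΔX⟩ : ∃ Δ > 0, ∀ y ∈ X, s' ≤ D y → 1 / 2 + Δ ≤ ζ y := by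
    have hQ : IsCompact (X ∩ {y | s' ≤ D y}) :=
      hXc.inter_right (isClosed_le continuous_const hDc)
    rcases (X ∩ {y | s' ≤ D y}).eq_empty_or_nonempty with he | hne
    · refine ⟨1, one_pos, fun y hy hy' => ?_⟩
      exact absurd (show y ∈ X ∩ {y | s' ≤ D y} from ⟨hy, hy'⟩) (by rw [he]; exact notMem_empty y)
    · obtain ⟨y₀, hy₀, hmin⟩ := hQ.exists_isMinOn hne hζc.continuousOn
      have : 1 / 2 < ζ y₀ := (hDpos y₀).2 (hs'0.trans_le hy₀.2)
      refine ⟨ζ y₀ - 1 / 2, by linarith, fun y hy hy' => ?_⟩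
      have := isMinOn_iff.1 hmin y ⟨hy, hy'⟩
      linarith
  set ρ : ℝ := (κ₁ - κ) * (s / 2) with hρ
  have hρ0 : 0 < ρ := mul_pos (by linarith) (by linarith)
  obtain ⟨t, htP, htf, htc⟩ := finite_approx_of_totallyBounded
    (hXc.totallyBounded.subset (s₁ := {x | x ∈ msupport μ ∧ 1 / 2 < ζ x})
      fun x hx => hself x hx.1 hx.2) (ρ / 2) (half_pos hρ0)
  obtain ⟨p, hp, hpt⟩ : ∃ p > 0, ∀ c ∈ t, p ≤ μ.real (ball c (ρ / 2)) := by
    have hpc : ∀ c ∈ t, 0 < μ.real (ball c (ρ / 2)) := fun c hc =>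
      ENNReal.toReal_pos ((htP hc).1 _ (half_pos hρ0)).ne' (measure_ne_top _ _)
    rcases t.eq_empty_or_nonempty with rfl | hne
    · exact ⟨1, one_pos, by simp⟩
    · obtain ⟨c, hc, hmin⟩ := htf.toFinset.exists_min_image (fun c => μ.real (ball c (ρ / 2)))
        (by simpa using hne)
      exact ⟨_, hpc c (by simpa using hc), fun c' hc' => hmin c' (by simpa using hc')⟩
  set C : ℝ := 4 * (d + 2) / Δ with hC
  have hlim : Tendsto (fun n : ℕ => ENNReal.ofReal (((n:ℝ) + 1) ^ (d + 1) *
      Real.exp (-(Δ / 4 * (C * Real.log n)))) +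
      ∑ _c ∈ htf.toFinset, ENNReal.ofReal (Real.exp (-(p / 16 * n)))) atTop (nhds 0) := by
    have h1 : Tendsto (fun n : ℕ => ENNReal.ofReal (Real.exp (-(p / 16 * n)))) atTop (nhds 0) := by
      have : Tendsto (fun n : ℕ => Real.exp (-(p / 16 * n))) atTop (nhds 0) :=
        Real.tendsto_exp_neg_atTop_nhds_zero.comp
          (tendsto_natCast_atTop_atTop.const_mul_atTop (by positivity))
      simpa using ENNReal.tendsto_ofReal this
    simpa using (tendsto_ballCut_bound d hΔ).add (tendsto_finsetSum htf.toFinset fun _ _ => h1)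
  have hnum := eventually_kernel_lt hpos hKdec hh0 hratio hK4 (a := κ₁ * (s / 2)) (R := max R 0)
    (c := κ₂ / κ₁) (b := Δ * (p / 2)) (C := C) (mul_pos (by linarith) (half_pos hs))
    (le_max_right _ _) ((one_lt_div (by linarith)).2 (by linarith)) (by positivity)
  filter_upwards [hlim.eventually_le_const (ENNReal.ofReal_pos.2 hδ), hnum] with n hn1 hn2
  refine le_trans ?_ hn1
  set dev : Set (Fin n → Eucl d × Bool) := {S | ∃ T, BallCut (fun i => (S i).1) T ∧
      (∀ i ∈ T, 1 / 2 + Δ ≤ 1 / 2 + τ * (η (S i).1 - 1 / 2)) ∧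
      ∑ i ∈ T, (τ * labelVal (S i).2 - Δ) < -(C * Real.log n)} with hdev
  set cnt : Eucl d → Set (Fin n → Eucl d × Bool) := fun c => {S |
    ((Finset.univ.filter fun i => (S i).1 ∈ ball c (ρ / 2)).card : ℝ) < n * (p / 2)} with hcnt
  set out : Set (Fin n → Eucl d × Bool) := {S | ∃ i, (S i).1 ∉ msupport μ} with hout
  have hsub : {S | ¬ μ (nonrobustSet K (h n) ζ τ κ S) ≤ ENNReal.ofReal ε} ⊆
      (dev ∪ ⋃ c ∈ htf.toFinset, cnt c) ∪ out := by
    intro S hSbad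
    by_contra hS
    refine hSbad ?_
    simp only [mem_union, not_or, mem_iUnion, not_exists] at hS
    obtain ⟨⟨hSdev, hScnt⟩, hSout⟩ := hS
    rw [hout, mem_ofPred_eq, not_exists] at hSout
    have hbad : nonrobustSet K (h n) ζ τ κ S ⊆
        (msupport μ)ᶜ ∪ {x | 0 < infDist x Z ∧ infDist x Z < s} := by
      rintro x ⟨hx1, hx2⟩
      by_contra hx3
      rw [mem_union, not_or, mem_compl_iff, not_not, mem_ofPred_eq, not_and, not_lt] at hx3
      obtain ⟨hxs, hxD⟩ := hx3
      replace hxD : s ≤ D x := hxD ((hDpos x).1 hx1)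
      refine hx2 fun x' hx' => ?_
      have hx'X : x' ∈ X := hX x hxs hx1 x' hx'
      replace hx' : dist x x' < κ * D x' := hx'
      have hD'R : D x' ≤ max R 0 :=
        (le_abs_self _).trans ((hR x' hx'X).trans (le_max_left _ _))
      have hD's : s / 2 ≤ D x' := by
        have := hDlip x x'
        have h0 : 0 ≤ D x' := infDist_nonneg
        nlinarith
      have hD'0 : 0 < D x' := (half_pos hs).trans_le hD's
      have hκ₁0 : 0 < κ₁ := by linarith
      have hr₁ : 0 < κ₁ * D x' := mul_pos hκ₁0 hD'0
      have hr : κ₁ * D x' < κ₂ * D x' := mul_lt_mul_of_pos_right (by linarith) hD'0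
      obtain ⟨c, hct, hxc⟩ : ∃ c ∈ t, x ∈ ball c (ρ / 2) := by
        have := htc (show x ∈ {x | x ∈ msupport μ ∧ 1 / 2 < ζ x} from ⟨hxs, hx1⟩)
        simpa using this
      refine kernel_vote_pos (hpos n) hK0 hKdec (fun i => (S i).1)
        (fun i => τ * labelVal (S i).2) (fun i => ?_) hΔ (L := C * Real.log n)
        (m := n * (p / 2)) (mul_nonneg (by positivity) (Real.log_natCast_nonneg n)) hr₁ hr x' ?_ ?_ ?_
      · rcases hτ with rfl | rfl <;> cases (S i).2 <;> simp [labelVal]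
      · intro T hT hTr
        by_contra hlt
        refine hSdev ⟨T, hT, fun i hi => ?_, not_le.1 hlt⟩
        rw [← hζ]
        have hDi : s' ≤ D (S i).1 := by
          have e1 := hDlip x' (S i).1
          have e2 : dist x' (S i).1 ≤ κ₂ * D x' := hTr i hi
          have e3 : (1 - κ₂) * (s / 2) ≤ (1 - κ₂) * D x' :=
            mul_le_mul_of_nonneg_left hD's (by linarith)
          linarith
        exact hΔX _ (hself _ (hSout i |> not_not.1) ((hDpos _).2 (hs'0.trans_le hDi))) hDi
      · have := hScnt c (by simpa using hct)
        rw [hcnt, mem_ofPred_eq, not_lt] at this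
        refine this.trans ?_
        refine Nat.cast_le.2 (Finset.card_le_card fun i hi => ?_)
        simp only [Finset.mem_filter, Finset.mem_univ, true_and, mem_ball] at hi ⊢ hxc
        have e1 := dist_triangle4 x' x c (S i).1
        rw [dist_comm x' x, dist_comm c] at e1
        have e2 : ρ ≤ (κ₁ - κ) * D x' := mul_le_mul_of_nonneg_left hD's (by linarith)
        linarith
      · have := hn2 (κ₁ * D x') (mul_le_mul_of_nonneg_left hD's hκ₁0.le) (by nlinarith)
        rw [show κ₂ / κ₁ * (κ₁ * D x') = κ₂ * D x' by field_simp] at this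
        linarith
    refine (measure_mono hbad).trans ((measure_union_le _ _).trans ?_)
    rw [msupport_mem_ae, zero_add]
    exact hμs
  refine (measure_mono hsub).trans ((measure_union_le _ _).trans ?_)
  rw [sampleD_exists_notMem_msupport μ hηm hη01 n, add_zero]
  refine (measure_union_le _ _).trans (add_le_add ?_ ?_)
  · exact sampleD_ballCut_deviation_le μ hηm hη01 hτ hΔ _
  · refine (measure_biUnion_finset_le _ _).trans (Finset.sum_le_sum fun c hc => ?_)
    exact sampleD_count_le μ hηm hη01 n measurableSet_ball (hpt c (by simpa using hc))

end OneSided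

section Astuteness

lemma accuracy_bayes_le_astuteness_add {d n : ℕ} {K : ℝ → ℝ} {h κ ε : ℝ} (μ : Measure (Eucl d))
    [IsProbabilityMeasure μ] {η : Eucl d → ℝ} (hη : Measurable η) (hη01 : ∀ x, η x ∈ Icc (0:ℝ) 1)
    (hε : 0 ≤ ε) (S : Fin n → Eucl d × Bool)
    (hμ : μ (nonrobustSet K h η 1 κ S ∪ nonrobustSet K h (fun x => 1 - η x) (-1) κ S) ≤
      ENNReal.ofReal ε) :
    accuracy μ η (bayes η) ≤ astuteness μ η (nbhdRegionK η κ) (kernelClassify K h S) + ε := by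
  have := isProbabilityMeasure_jointD μ hη hη01
  set B := nonrobustSet K h η 1 κ S ∪ nonrobustSet K h (fun x => 1 - η x) (-1) κ S with hB
  set M := toMeasurable μ B with hM
  set s : Set (Eucl d × Bool) := {p | ∀ x' ∈ nbhdRegionK η κ p.1, kernelClassify K h S x' = p.2}
    with hs
  have hbayes : MeasurableSet {p : Eucl d × Bool | bayes η p.1 = p.2} :=
    measurableSet_eq_fun ((Measurable.ite (measurableSet_le measurable_const hη)
      measurable_const measurable_const).comp measurable_fst) measurable_snd
  have htrue : ∀ x ∉ B, 1 / 2 < η x → (x, true) ∈ s := by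
    intro x hx hx1 x' hx'
    rw [nbhdRegionK, if_pos hx1] at hx'
    have hv : 0 < ∑ i, K (dist x' (S i).1 / h) * (1 * labelVal (S i).2) := by
      by_contra hc
      exact hx (Or.inl ⟨hx1, fun hall => hc (hall x' hx')⟩)
    simp only [one_mul] at hv
    exact if_pos hv
  have hfalse : ∀ x ∉ B, η x < 1 / 2 → (x, false) ∈ s := by
    intro x hx hx1 x' hx'
    rw [nbhdRegionK, if_neg hx1.not_gt, if_pos hx1] at hx'
    have hZ : {z | 1 - η z ≤ 1 / 2} = {z | 1 / 2 ≤ η z} := by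
      ext z
      simp only [mem_ofPred_eq]
      constructor <;> intro <;> linarith
    have hv : 0 < ∑ i, K (dist x' (S i).1 / h) * (-1 * labelVal (S i).2) := by
      by_contra hc
      exact hx (Or.inr ⟨by linarith, fun hall => hc (hall x' (by rw [hZ]; exact hx'))⟩)
    simp only [neg_one_mul, mul_neg, Finset.sum_neg_distrib] at hv
    exact if_neg (by linarith)
  have hhalf : ∀ x, η x = 1 / 2 → (x, kernelClassify K h S x) ∈ s := by
    intro x hx x' hx'
    rw [nbhdRegionK, if_neg (by linarith), if_neg (by linarith)] at hx'
    rw [mem_singleton_iff.1 hx']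
  have hpt : ∀ x, ENNReal.ofReal (η x) * {p | bayes η p.1 = p.2}.indicator 1 (x, true) +
        ENNReal.ofReal (1 - η x) * {p | bayes η p.1 = p.2}.indicator 1 (x, false) ≤
      (ENNReal.ofReal (η x) * s.indicator 1 (x, true) +
        ENNReal.ofReal (1 - η x) * s.indicator 1 (x, false)) + M.indicator 1 x := by
    intro x
    by_cases hxM : x ∈ M
    · rw [indicator_of_mem hxM, Pi.one_apply, ← ofReal_add_ofReal_one_sub (hη01 x)]
      refine le_trans ?_ le_add_self
      gcongr <;> exact mul_le_of_le_one_right' (indicator_le_self' (by simp) _)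
    · have hxB : x ∉ B := fun hx => hxM (subset_toMeasurable μ B hx)
      refine le_trans ?_ le_self_add
      rcases lt_trichotomy (η x) (1 / 2) with hlt | heq | hgt
      · have hb : bayes η x = false := if_neg (not_le.2 hlt)
        rw [indicator_of_mem (hfalse x hxB hlt)]
        simp [hb]
      · have hb : bayes η x = true := if_pos heq.ge
        have h2 : 1 - η x = η x := by linarith
        have h3 := hhalf x heq
        rw [h2]
        cases hk : kernelClassify K h S x <;> rw [hk] at h3 <;> rw [indicator_of_mem h3] <;>
          simp [hb]
      · have hb : bayes η x = true := if_pos hgt.le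
        rw [indicator_of_mem (htrue x hxB hgt)]
        simp [hb]
  have hle : jointD μ η {p | bayes η p.1 = p.2} ≤ jointD μ η s + ENNReal.ofReal ε := by
    rw [jointD_apply μ hη hbayes]
    refine (lintegral_mono hpt).trans ?_
    have hMm : MeasurableSet M := measurableSet_toMeasurable μ B
    rw [lintegral_add_right _ (measurable_one.indicator hMm), lintegral_indicator_one hMm, hM,
      measure_toMeasurable]
    exact add_le_add (le_jointD μ hη s) hμ
  have := ENNReal.toReal_mono (by finiteness) hle
  rwa [ENNReal.toReal_add (by finiteness) (by finiteness), ENNReal.toReal_ofReal hε] at this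

end Astuteness

section Statements

open MeasureTheory Metric Set Filter Topology
open scoped ENNReal Classical

/-- sufficient conditions for a kernel classifier to be neighborhood
consistent. -/
theorem stmt6 {d : ℕ} (K : ℝ → ℝ) (h : ℕ → ℝ) (hpos : ∀ n, 0 < h n)
    (hK0 : ∀ x : ℝ, 0 ≤ x → 0 ≤ K x) (hKdec : AntitoneOn K (Ici 0))
    (hKint : Integrable fun x : Eucl d => K ‖x‖)
    (hh0 : Tendsto h atTop (nhds 0))
    (hnh : Tendsto (fun n : ℕ => (n : ℝ) * h n ^ d) atTop atTop)
    (hratio : ∀ c > (1:ℝ), Tendsto (fun x => K (c * x) / K x) atTop (nhds 0))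
    (hK4 : ∀ x : ℝ, 0 ≤ x →
      Tendsto (fun n : ℕ => (n : ℝ) / Real.log n * K (x / h n)) atTop atTop)
    (μ : Measure (Eucl d)) [IsProbabilityMeasure μ] (η : Eucl d → ℝ)
    (hηc : Continuous η) (hη01 : ∀ x, η x ∈ Icc (0:ℝ) 1)
    (hcompact : ∃ Xc : Set (Eucl d), IsCompact Xc ∧
      ∀ κ ∈ Ioo (0:ℝ) 1, ∀ x ∈ msupport μ, nbhdRegionK η κ x ⊆ Xc) :
    ∀ ε ∈ Ioo (0:ℝ) 1, ∀ δ ∈ Ioo (0:ℝ) 1, ∀ κ ∈ Ioo (0:ℝ) 1, ∃ N : ℕ, ∀ n ≥ N,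
      ENNReal.ofReal (1 - δ) ≤ sampleD μ η n
        {S | accuracy μ η (bayes η) - ε ≤
          astuteness μ η (nbhdRegionK η κ) (kernelClassify K (h n) S)} := by
  intro ε hε δ hδ κ hκ
  obtain ⟨X, hXc, hX⟩ := hcompact
  have hη1c : Continuous fun x => 1 - η x := continuous_const.sub hηc
  have hplus := eventually_sampleD_nonrobustSet_le hpos hK0 hKdec hh0 hratio hK4 μ hηc hη01
    (τ := 1) (ζ := η) (Or.inl rfl) (fun x => by ring) hκ hXc
    (fun x hx hx1 x' hx' => hX κ hκ x hx (by rw [nbhdRegionK, if_pos hx1]; exact hx'))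
    (half_pos hε.1) (half_pos hδ.1)
  have hminus := eventually_sampleD_nonrobustSet_le hpos hK0 hKdec hh0 hratio hK4 μ hηc hη01
    (τ := -1) (ζ := fun x => 1 - η x) (Or.inr rfl) (fun x => by ring) hκ hXc
    (fun x hx hx1 x' hx' => hX κ hκ x hx (by
      have hlt : η x < 1 / 2 := by linarith
      have hZ : {z | 1 - η z ≤ 1 / 2} = {z | 1 / 2 ≤ η z} := by
        ext z
        simp only [mem_ofPred_eq]
        constructor <;> intro <;> linarith
      rw [nbhdRegionK, if_neg hlt.not_gt, if_pos hlt, ← hZ]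
      exact hx'))
    (half_pos hε.1) (half_pos hδ.1)
  obtain ⟨N, hN⟩ := eventually_atTop.1 (hplus.and hminus)
  refine ⟨N, fun n hn => ?_⟩
  obtain ⟨hn1, hn2⟩ := hN n hn
  have := isProbabilityMeasure_jointD μ hηc.measurable hη01
  have : IsProbabilityMeasure (sampleD μ η n) := by unfold sampleD; infer_instance
  set G := {S : Fin n → Eucl d × Bool | accuracy μ η (bayes η) - ε ≤
    astuteness μ η (nbhdRegionK η κ) (kernelClassify K (h n) S)} with hG
  set P := {S | ¬ μ (nonrobustSet K (h n) η 1 κ S) ≤ ENNReal.ofReal (ε / 2)} with hP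
  set Q := {S | ¬ μ (nonrobustSet K (h n) (fun x => 1 - η x) (-1) κ S) ≤
    ENNReal.ofReal (ε / 2)} with hQ
  have hcover : univ ⊆ G ∪ (P ∪ Q) := by
    intro S _
    by_contra hS
    simp only [mem_union, not_or] at hS
    obtain ⟨hSG, hSP, hSQ⟩ := hS
    rw [hP, mem_ofPred_eq, not_not] at hSP
    rw [hQ, mem_ofPred_eq, not_not] at hSQ
    refine hSG ?_
    have := accuracy_bayes_le_astuteness_add (K := K) (h := h n) (κ := κ) μ hηc.measurable hη01
      hε.1.le S ((measure_union_le _ _).trans ((add_le_add hSP hSQ).trans_eq (by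
        rw [← ENNReal.ofReal_add (half_pos hε.1).le (half_pos hε.1).le, add_halves])))
    rw [hG, mem_ofPred_eq]
    linarith
  have htotal : 1 ≤ sampleD μ η n G + ENNReal.ofReal δ := by
    rw [← measure_univ (μ := sampleD μ η n)]
    refine (measure_mono hcover).trans ((measure_union_le _ _).trans ?_)
    gcongr
    refine (measure_union_le _ _).trans ((add_le_add hn1 hn2).trans_eq ?_)
    rw [← ENNReal.ofReal_add (half_pos hδ.1).le (half_pos hδ.1).le, add_halves]
  rw [ENNReal.ofReal_sub _ hδ.1.le, ENNReal.ofReal_one]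
  exact tsub_le_iff_right.2 htotal

end Statements
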